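/- Let P be a full-support joint distribution on Ω, fix a linear order on ι, and let (Π_i)_{i∈ι} and (Π̃_i)_{i∈ι} be two parent assignments with Bayesian projections Q and Q̃ respectively. Then D_KL(P ‖ Q) ≤ D_KL(P ‖ Q̃) if and only if Σ_{i ∈ ι} I({i} ; Π_i) ≥ Σ_{i ∈ ι} I({i} ; Π̃_i); that is, since the entropy terms are independent of the parent assignment, minimizing the Kullback–Leibler divergence to the Bayesian projection is equivalent to maximizing the total mutual information between each attribute and its parent set. -/

import Mathlib

open scoped BigOperators

namespace CausalPre

variable {ι : Type*} [Fintype ι] [DecidableEq ι]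
variable {F : ι → Type*} [∀ i, Fintype (F i)] [∀ i, DecidableEq (F i)]
  [∀ i, Nonempty (F i)]

/-- Restriction of a full configuration to the coordinates in `S`. -/
def restrict (S : Finset ι) (x : ∀ i, F i) : ∀ i : S, F i := fun i => x i

/-- `P` is a joint distribution on `Ω = Π i, F i`. -/
def IsJoint (P : (∀ i, F i) → ℝ) : Prop :=
  (∀ x, 0 ≤ P x) ∧ ∑ x, P x = 1

/-- `P` has full support. -/
def FullSupport (P : (∀ i, F i) → ℝ) : Prop := ∀ x, 0 < P x

/-- Marginal of `P` on the coordinates in `S`. -/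
noncomputable def marginal (P : (∀ i, F i) → ℝ) (S : Finset ι)
    (s : ∀ i : S, F i) : ℝ :=
  ∑ x : ∀ i, F i, if restrict S x = s then P x else 0

/-- Conditional probability `P[T | S]`, evaluated at the restrictions of a full
configuration `x`:  `P[T | S](x_T | x_S) = P_{S ∪ T}(x_{S ∪ T}) / P_S(x_S)`. -/
noncomputable def condProb (P : (∀ i, F i) → ℝ) (T S : Finset ι)
    (x : ∀ i, F i) : ℝ :=
  marginal P (S ∪ T) (restrict (S ∪ T) x) / marginal P S (restrict S x)

/-- Entropy of the marginal of `P` on `S`. -/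
noncomputable def entropy (P : (∀ i, F i) → ℝ) (S : Finset ι) : ℝ :=
  -∑ s : ∀ i : S, F i, marginal P S s * Real.log (marginal P S s)

/-- Mutual information `I(S ; T)` of disjoint `S`, `T`. -/
noncomputable def mutualInfo (P : (∀ i, F i) → ℝ) (S T : Finset ι) : ℝ :=
  entropy P S + entropy P T - entropy P (S ∪ T)

/-- Conditional entropy `H(S | T)` for disjoint `S`, `T`. -/
noncomputable def condEntropy (P : (∀ i, F i) → ℝ) (S T : Finset ι) : ℝ :=
  entropy P (S ∪ T) - entropy P T

/-- Conditional mutual information `I(S ; T | U)` of pairwise disjoint `S`, `T`, `U`. -/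
noncomputable def condMutualInfo (P : (∀ i, F i) → ℝ) (S T U : Finset ι) : ℝ :=
  entropy P (S ∪ U) + entropy P (T ∪ U) - entropy P (S ∪ T ∪ U) - entropy P U

/-- Kullback–Leibler divergence `D_KL(P ‖ Q) = Σ_{x : P(x) > 0} P(x) log (P(x)/Q(x))`. -/
noncomputable def klDiv (P Q : (∀ i, F i) → ℝ) : ℝ :=
  ∑ x, if 0 < P x then P x * Real.log (P x / Q x) else 0

variable [LinearOrder ι]

/-- A parent assignment with respect to a linear order: `Pa i ⊆ {j : j < i}`. -/
def IsParentAssignment (Pa : ι → Finset ι) : Prop :=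
  ∀ i, ∀ j ∈ Pa i, j < i

/-- Bayesian projection of `P` with respect to a parent assignment:
`Q(x) = Π_i P[{i} | Pa i](x_i | x_{Pa i})`. -/
noncomputable def bayesProj (P : (∀ i, F i) → ℝ) (Pa : ι → Finset ι)
    (x : ∀ i, F i) : ℝ :=
  ∏ i, condProb P {i} (Pa i) x

/-- The marginal on `S` is positive at the restriction of any configuration. -/
lemma marginal_restrict_pos {P : (∀ i, F i) → ℝ} (hfull : FullSupport P) (S : Finset ι)
    (x : ∀ i, F i) : 0 < marginal P S (restrict S x) := by
  unfold marginal
  refine Finset.sum_pos' (fun y _ => ?_) ⟨x, Finset.mem_univ _, by simpa using hfull x⟩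
  split_ifs
  · exact (hfull y).le
  · exact le_rfl

/-- Entropy as an expectation over full configurations. -/
lemma sum_mul_log_marginal_restrict (P : (∀ i, F i) → ℝ) (S : Finset ι) :
    ∑ x, P x * Real.log (marginal P S (restrict S x)) = -entropy P S := by
  unfold entropy
  rw [neg_neg]
  conv_rhs =>
    enter [2, s]
    rw [marginal, Finset.sum_mul]
  rw [Finset.sum_comm]
  refine Finset.sum_congr rfl fun x _ => ?_
  simp only [ite_mul, zero_mul, Finset.sum_ite_eq, Finset.mem_univ, if_true]
  rfl

/-- The expected logarithm of a conditional probability is minus the conditional entropy. -/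
lemma sum_mul_log_condProb {P : (∀ i, F i) → ℝ} (hfull : FullSupport P) (T S : Finset ι) :
    ∑ x, P x * Real.log (condProb P T S x) = mutualInfo P T S - entropy P T := by
  have hlog : ∀ x, P x * Real.log (condProb P T S x) =
      P x * Real.log (marginal P (S ∪ T) (restrict (S ∪ T) x)) -
        P x * Real.log (marginal P S (restrict S x)) := fun x => by
    rw [condProb, Real.log_div (marginal_restrict_pos hfull _ x).ne'
      (marginal_restrict_pos hfull _ x).ne', mul_sub]
  simp only [hlog, Finset.sum_sub_distrib, sum_mul_log_marginal_restrict, mutualInfo]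
  rw [Finset.union_comm S T]
  ring

/-- The divergence from `P` to its Bayesian projection, in terms of entropies and mutual
information. -/
lemma klDiv_bayesProj {P : (∀ i, F i) → ℝ} (hfull : FullSupport P) (Pa : ι → Finset ι) :
    klDiv P (bayesProj P Pa) =
      ∑ x, P x * Real.log (P x) + ∑ i, entropy P {i} - ∑ i, mutualInfo P {i} (Pa i) := by
  have hcond : ∀ i x, 0 < condProb P {i} (Pa i) x := fun i x =>
    div_pos (marginal_restrict_pos hfull _ x) (marginal_restrict_pos hfull _ x)
  have hterm : ∀ x, (if 0 < P x then P x * Real.log (P x / bayesProj P Pa x) else 0) =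
      P x * Real.log (P x) - ∑ i, P x * Real.log (condProb P {i} (Pa i) x) := fun x => by
    rw [if_pos (hfull x), bayesProj, Real.log_div (hfull x).ne'
      (Finset.prod_pos fun i _ => hcond i x).ne',
      Real.log_prod fun i _ => (hcond i x).ne', mul_sub, Finset.mul_sum]
  simp only [klDiv, hterm, Finset.sum_sub_distrib]
  rw [Finset.sum_comm]
  simp only [sum_mul_log_condProb hfull, Finset.sum_sub_distrib]
  ring

/-- For a full-support joint distribution `P` and two parent
assignments `Pa`, `Pa'` with Bayesian projections `Q`, `Q'`:
`D_KL(P ‖ Q) ≤ D_KL(P ‖ Q')` iff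
`Σ_i I({i} ; Pa i) ≥ Σ_i I({i} ; Pa' i)`; i.e. minimizing the KL divergence to
the Bayesian projection is equivalent to maximizing the total mutual
information between each attribute and its parent set. -/
theorem klDiv_bayesProj_le_iff_mutualInfo_ge
    (P : (∀ i, F i) → ℝ) (hP : IsJoint P) (hfull : FullSupport P)
    (Pa Pa' : ι → Finset ι)
    (hPa : IsParentAssignment Pa) (hPa' : IsParentAssignment Pa') :
    klDiv P (bayesProj P Pa) ≤ klDiv P (bayesProj P Pa') ↔
      ∑ i, mutualInfo P {i} (Pa' i) ≤ ∑ i, mutualInfo P {i} (Pa i) := by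
  rw [klDiv_bayesProj hfull, klDiv_bayesProj hfull]
  exact sub_le_sub_iff_left _

end CausalPre
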